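/- For every real x > 0: 𝓕(2x) + 𝓕(x/2) + 𝓕((x+1)/2) + 𝓕(2x/(x+1)) − 3·𝓕(x) = L(x/(x+1)) − L(1/2) + ½·log(2)·log(x). -/

import Mathlib

open Real

/-- The digamma function ψ = Γ′/Γ. -/
noncomputable def digamma (x : ℝ) : ℝ := deriv Real.Gamma x / Real.Gamma x

/-- The Herglotz function F(x) = ∑_{n≥1} (ψ(nx) − log(nx))/n. -/
noncomputable def herglotzF (x : ℝ) : ℝ :=
  ∑' n : ℕ, (digamma (((n : ℝ) + 1) * x) - Real.log (((n : ℝ) + 1) * x)) / ((n : ℝ) + 1)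

/-- The modified Herglotz function 𝓕(x) = F(x) − F(1) + (π²/12)(x − 2 + 1/x) − (log x)²/4. -/
noncomputable def mathcalF (x : ℝ) : ℝ :=
  herglotzF x - herglotzF 1 + Real.pi ^ 2 / 12 * (x - 2 + 1 / x) - Real.log x ^ 2 / 4

/-- The dilogarithm Li₂(x) = ∑_{n≥1} xⁿ/n². -/
noncomputable def Li2 (x : ℝ) : ℝ := ∑' n : ℕ, x ^ (n + 1) / ((n : ℝ) + 1) ^ 2

open Classical in
/-- The Rogers dilogarithm, extended to all of ℝ. -/
noncomputable def rogersL (x : ℝ) : ℝ :=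
  if x < 0 then -(Li2 (x / (x - 1)) + Real.log (x / (x - 1)) * Real.log (1 - x / (x - 1)) / 2)
  else if x ≤ 1 then Li2 x + Real.log x * Real.log (1 - x) / 2
  else Real.pi ^ 2 / 3 - (Li2 (1 / x) + Real.log (1 / x) * Real.log (1 - 1 / x) / 2)

section

open Set MeasureTheory Filter Topology

/-- The Bose kernel `1 / (eᵗ - 1)`. -/
noncomputable def boseKernel (t : ℝ) : ℝ := 1 / (Real.exp t - 1)

/-- Binet's kernel `1 / (1 - e⁻ᵗ) - 1 / t`, written through the Bose kernel. -/
noncomputable def binetKernel (t : ℝ) : ℝ := 1 + boseKernel t - 1 / t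

theorem exp_sub_one_pos {t : ℝ} (ht : 0 < t) : 0 < Real.exp t - 1 := by
  linarith [Real.add_one_lt_exp ht.ne']

theorem boseKernel_pos {t : ℝ} (ht : 0 < t) : 0 < boseKernel t :=
  one_div_pos.2 (exp_sub_one_pos ht)

@[fun_prop]
theorem measurable_boseKernel : Measurable boseKernel := by
  unfold boseKernel; fun_prop

@[fun_prop]
theorem measurable_binetKernel : Measurable binetKernel := by
  unfold binetKernel; fun_prop

theorem boseKernel_le_one_div {t : ℝ} (ht : 0 < t) : boseKernel t ≤ 1 / t :=
  one_div_le_one_div_of_le ht (by linarith [Real.add_one_le_exp t])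

theorem binetKernel_le_one {t : ℝ} (ht : 0 < t) : binetKernel t ≤ 1 := by
  unfold binetKernel; linarith [boseKernel_le_one_div ht]

theorem one_add_boseKernel {t : ℝ} (ht : 0 < t) :
    1 + boseKernel t = 1 / (1 - Real.exp (-t)) := by
  have h := exp_sub_one_pos ht
  have h' : 1 - Real.exp (-t) ≠ 0 := by
    have : Real.exp (-t) < 1 := Real.exp_lt_one_iff.2 (by linarith)
    linarith
  unfold boseKernel
  rw [eq_div_iff h', Real.exp_neg]
  field_simp
  ring

theorem binetKernel_nonneg {t : ℝ} (ht : 0 < t) : 0 ≤ binetKernel t := by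
  have : Real.exp (-t) < 1 := Real.exp_lt_one_iff.2 (by linarith)
  unfold binetKernel
  rw [one_add_boseKernel ht, sub_nonneg]
  exact one_div_le_one_div_of_le (by linarith) (by linarith [Real.add_one_le_exp (-t)])

theorem hasDerivAt_log_Gamma {y : ℝ} (hy : 0 < y) :
    HasDerivAt (Real.log ∘ Real.Gamma) (digamma y) y := by
  have h : DifferentiableAt ℝ Real.Gamma y :=
    Real.differentiableAt_Gamma fun m => by have : (0 : ℝ) ≤ m := m.cast_nonneg; linarith
  exact h.hasDerivAt.log (Real.Gamma_pos_of_pos hy).ne'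

theorem log_Gamma_add_one {y : ℝ} (hy : 0 < y) :
    (Real.log ∘ Real.Gamma) (y + 1) = Real.log y + (Real.log ∘ Real.Gamma) y := by
  simp only [Function.comp_apply]
  rw [Real.Gamma_add_one hy.ne', Real.log_mul hy.ne' (Real.Gamma_pos_of_pos hy).ne']

theorem digamma_add_one {y : ℝ} (hy : 0 < y) : digamma (y + 1) = digamma y + 1 / y := by
  have h1 : HasDerivAt (fun z => (Real.log ∘ Real.Gamma) (z + 1)) (digamma (y + 1)) y :=
    (hasDerivAt_log_Gamma (by linarith)).comp_add_const y 1
  have h2 := (Real.hasDerivAt_log hy.ne').add (hasDerivAt_log_Gamma hy)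
  have h3 := h1.congr_of_eventuallyEq (f₁ := Real.log + Real.log ∘ Real.Gamma) (by
    filter_upwards [lt_mem_nhds hy] with z hz
    rw [log_Gamma_add_one hz, Pi.add_apply])
  rw [h3.unique h2]
  ring

theorem digamma_le_log {y : ℝ} (hy : 0 < y) : digamma y ≤ Real.log y := by
  have h := Real.convexOn_log_Gamma.le_slope_of_hasDerivAt (mem_Ioi.2 hy)
    (mem_Ioi.2 (by linarith : 0 < y + 1)) (by linarith) (hasDerivAt_log_Gamma hy)
  rw [slope_def_field, log_Gamma_add_one hy] at h
  simpa using h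

theorem log_le_digamma_add_one {y : ℝ} (hy : 0 < y) : Real.log y ≤ digamma (y + 1) := by
  have h := Real.convexOn_log_Gamma.slope_le_of_hasDerivAt (mem_Ioi.2 hy)
    (mem_Ioi.2 (by linarith : 0 < y + 1)) (by linarith)
    (hasDerivAt_log_Gamma (by linarith : 0 < y + 1))
  rw [slope_def_field, log_Gamma_add_one hy] at h
  simpa using h

theorem integrableOn_exp_neg_mul {y : ℝ} (hy : 0 < y) :
    IntegrableOn (fun t => Real.exp (-(y * t))) (Ioi 0) := by
  simpa using exp_neg_integrableOn_Ioi 0 hy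

theorem integral_exp_neg_mul {y : ℝ} (hy : 0 < y) :
    ∫ t in Ioi 0, Real.exp (-(y * t)) = 1 / y := by
  have := integral_exp_mul_Ioi (neg_lt_zero.2 hy) 0
  simpa using this

theorem integrableOn_of_abs_le {f g : ℝ → ℝ} (hf : Measurable f) (hg : IntegrableOn g (Ioi 0))
    (h : ∀ t, 0 < t → |f t| ≤ g t) : IntegrableOn f (Ioi 0) :=
  hg.mono' hf.aestronglyMeasurable
    ((ae_restrict_mem measurableSet_Ioi).mono fun t ht => h t ht)

theorem integrableOn_binetKernel_mul_exp {y : ℝ} (hy : 0 < y) :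
    IntegrableOn (fun t => binetKernel t * Real.exp (-(y * t))) (Ioi 0) := by
  refine integrableOn_of_abs_le (by fun_prop) (integrableOn_exp_neg_mul hy) fun t ht => ?_
  rw [abs_mul, abs_of_nonneg (binetKernel_nonneg ht), Real.abs_exp]
  exact mul_le_of_le_one_left (Real.exp_pos _).le (binetKernel_le_one ht)

theorem integral_binetKernel_mul_exp_nonneg (y : ℝ) :
    0 ≤ ∫ t in Ioi 0, binetKernel t * Real.exp (-(y * t)) :=
  setIntegral_nonneg measurableSet_Ioi fun _ ht =>
    mul_nonneg (binetKernel_nonneg ht) (Real.exp_pos _).le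

theorem integral_binetKernel_mul_exp_le {y : ℝ} (hy : 0 < y) :
    ∫ t in Ioi 0, binetKernel t * Real.exp (-(y * t)) ≤ 1 / y := by
  rw [← integral_exp_neg_mul hy]
  exact setIntegral_mono_on (integrableOn_binetKernel_mul_exp hy) (integrableOn_exp_neg_mul hy)
    measurableSet_Ioi fun t ht =>
      mul_le_of_le_one_left (Real.exp_pos _).le (binetKernel_le_one ht)

theorem integral_binetKernel_mul_exp_sub {y : ℝ} (hy : 0 < y) :
    (∫ t in Ioi 0, binetKernel t * Real.exp (-(y * t)))
      - ∫ t in Ioi 0, binetKernel t * Real.exp (-((y + 1) * t))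
      = 1 / y - Real.log ((y + 1) / y) := by
  have hy1 : 0 < y + 1 := by linarith
  have hint : IntegrableOn (fun t => binetKernel t * Real.exp (-(y * t)) -
      binetKernel t * Real.exp (-((y + 1) * t))) (Ioi 0) :=
    (integrableOn_binetKernel_mul_exp hy).sub (integrableOn_binetKernel_mul_exp hy1)
  have key : ∀ t ∈ Ioi (0 : ℝ), Real.exp (-(y * t)) -
      (binetKernel t * Real.exp (-(y * t)) - binetKernel t * Real.exp (-((y + 1) * t))) =
      t⁻¹ • (Real.exp (-(y * t)) - Real.exp (-((y + 1) * t))) := by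
    intro t ht
    have h1 : Real.exp (-((y + 1) * t)) = Real.exp (-(y * t)) * Real.exp (-t) := by
      rw [← Real.exp_add]; ring_nf
    have h2 : 1 - Real.exp (-t) ≠ 0 := by
      have : Real.exp (-t) < 1 := Real.exp_lt_one_iff.2 (neg_lt_zero.2 ht)
      linarith
    have h3 : t ≠ 0 := (mem_Ioi.1 ht).ne'
    unfold binetKernel
    rw [one_add_boseKernel ht, h1, smul_eq_mul]
    field_simp
    ring
  have hc : Continuous fun u : ℝ => Real.exp (-u) := by fun_prop
  have hfr := Frullani.integral_Ioi_eq (f := fun u => Real.exp (-u)) (L := 1) (R := 0) (a := y)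
    (b := y + 1) (hc.locallyIntegrable.locallyIntegrableOn _) hy hy1
    (by simpa using (hc.tendsto 0).mono_left nhdsWithin_le_nhds)
    (Real.tendsto_exp_neg_atTop_nhds_zero)
    (((integrableOn_exp_neg_mul hy).sub hint).congr_fun key measurableSet_Ioi)
  rw [← integral_sub (integrableOn_binetKernel_mul_exp hy) (integrableOn_binetKernel_mul_exp hy1)]
  rw [← setIntegral_congr_fun measurableSet_Ioi key,
    integral_sub (integrableOn_exp_neg_mul hy) hint, integral_exp_neg_mul hy] at hfr
  simp only [smul_eq_mul, sub_zero, mul_one] at hfr ⊢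
  linarith

/-- Binet's integral representation of the digamma function. -/
theorem digamma_sub_log_eq_integral {y : ℝ} (hy : 0 < y) :
    digamma y - Real.log y = -∫ t in Ioi 0, binetKernel t * Real.exp (-(y * t)) := by
  set g : ℝ → ℝ := fun y =>
    digamma y - Real.log y + ∫ t in Ioi 0, binetKernel t * Real.exp (-(y * t)) with hg
  have hper : ∀ z, 0 < z → g (z + 1) = g z := by
    intro z hz
    have h := integral_binetKernel_mul_exp_sub hz
    rw [Real.log_div (by linarith) hz.ne'] at h
    simp only [hg]
    rw [digamma_add_one hz]
    linarith
  have hbd : ∀ z, 0 < z → |g z| ≤ 1 / z := by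
    intro z hz
    have h1 := digamma_le_log hz
    have h2 := log_le_digamma_add_one hz
    rw [digamma_add_one hz] at h2
    have h3 := integral_binetKernel_mul_exp_nonneg z
    have h4 := integral_binetKernel_mul_exp_le hz
    rw [abs_le]
    constructor <;> simp only [hg] <;> linarith
  have hnat : ∀ n : ℕ, g (y + n) = g y := by
    intro n
    induction n with
    | zero => simp
    | succ n ih =>
      rw [← ih, ← hper (y + n) (by positivity)]
      push_cast
      ring_nf
  have hlim : Tendsto (fun n : ℕ => 1 / (y + n)) atTop (𝓝 0) := by
    simp_rw [one_div]
    exact (tendsto_atTop_add_const_left _ y tendsto_natCast_atTop_atTop).inv_tendsto_atTop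
  have h0 : |g y| ≤ 0 := ge_of_tendsto' hlim fun n => by
    rw [← hnat n]; exact hbd _ (by positivity)
  have := abs_nonpos_iff.1 h0
  simp only [hg] at this
  linarith

theorem boseKernel_le_exp {u : ℝ} (hu : 0 < u) :
    boseKernel u ≤ 1 / u * Real.exp (-(u / 2)) := by
  have h1 : u / 2 ≤ Real.sinh (u / 2) := Real.self_le_sinh_iff.2 (by linarith)
  rw [Real.sinh_eq] at h1
  have h2 : Real.exp u = Real.exp (u / 2) * Real.exp (u / 2) := by
    rw [← Real.exp_add]; ring_nf
  have h3 : Real.exp (-(u / 2)) * Real.exp (u / 2) = 1 := by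
    rw [← Real.exp_add]; simp
  have h4 := Real.exp_pos (u / 2)
  unfold boseKernel
  rw [div_le_iff₀ (exp_sub_one_pos hu), div_mul_eq_mul_div, one_mul, div_mul_eq_mul_div,
    le_div_iff₀ hu, h2]
  nlinarith [Real.exp_pos (-(u / 2))]

theorem mul_boseKernel_le_exp {b x t : ℝ} (hb : 0 < b) (hbx : b ≤ x) (ht : 0 < t) :
    t * boseKernel (x * t) ≤ 1 / b * Real.exp (-(b / 2 * t)) := by
  have hx : 0 < x := hb.trans_le hbx
  calc t * boseKernel (x * t) ≤ t * (1 / (x * t) * Real.exp (-(x * t / 2))) := by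
        gcongr; exact boseKernel_le_exp (by positivity)
    _ = 1 / x * Real.exp (-(x * t / 2)) := by field_simp
    _ ≤ 1 / b * Real.exp (-(b / 2 * t)) := by
        gcongr
        nlinarith

theorem log_one_sub_exp_neg {u : ℝ} (hu : 0 < u) :
    Real.log (1 - Real.exp (-u)) = -Real.log (1 + boseKernel u) := by
  rw [one_add_boseKernel hu, one_div, Real.log_inv, neg_neg]

theorem abs_log_one_sub_exp_neg_le {u : ℝ} (hu : 0 < u) :
    |Real.log (1 - Real.exp (-u))| ≤ 2 * (u ^ (-(1 / 2) : ℝ) * Real.exp (-(u / 4))) := by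
  have hh := boseKernel_pos hu
  rw [log_one_sub_exp_neg hu, abs_neg, abs_of_nonneg (Real.log_nonneg (by linarith))]
  have h1 : Real.log (1 + boseKernel u) ≤ 2 * √(boseKernel u) := by
    have h2 : Real.log (1 + boseKernel u) ≤ 2 * Real.log (1 + √(boseKernel u)) := by
      rw [← Real.log_rpow (by positivity), Real.rpow_two]
      apply Real.log_le_log (by linarith)
      nlinarith [Real.sq_sqrt hh.le, Real.sqrt_nonneg (boseKernel u)]
    linarith [Real.log_le_sub_one_of_pos (by positivity : 0 < 1 + √(boseKernel u))]
  refine h1.trans ?_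
  gcongr
  apply Real.sqrt_le_iff.2 ⟨by positivity, (boseKernel_le_exp hu).trans_eq ?_⟩
  rw [mul_pow, ← Real.rpow_natCast (u ^ _), ← Real.rpow_mul hu.le, ← Real.exp_nat_mul]
  rw [show (-(1 / 2) : ℝ) * (2 : ℕ) = -1 by norm_num, Real.rpow_neg_one, one_div]
  congr 2
  push_cast
  ring

theorem integrableOn_binetKernel_mul_log {x : ℝ} (hx : 0 < x) :
    IntegrableOn (fun t => binetKernel t * Real.log (1 - Real.exp (-(x * t)))) (Ioi 0) := by
  have h := (integrableOn_rpow_mul_exp_neg_mul_rpow (s := -(1 / 2)) (p := 1) (b := x / 4)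
    (by norm_num) one_pos (by positivity)).const_mul (2 * x ^ (-(1 / 2) : ℝ))
  refine integrableOn_of_abs_le (by fun_prop) h fun t ht => ?_
  rw [abs_mul, abs_of_nonneg (binetKernel_nonneg ht)]
  refine (mul_le_of_le_one_left (abs_nonneg _) (binetKernel_le_one ht)).trans
    ((abs_log_one_sub_exp_neg_le (by positivity)).trans_eq ?_)
  rw [Real.mul_rpow hx.le ht.le, Real.rpow_one]
  ring_nf

theorem herglotzF_eq_integral {x : ℝ} (hx : 0 < x) :
    herglotzF x = ∫ t in Ioi 0, binetKernel t * Real.log (1 - Real.exp (-(x * t))) := by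
  set G : ℕ → ℝ → ℝ := fun n t =>
    -1 / ((n : ℝ) + 1) * (binetKernel t * Real.exp (-(((n : ℝ) + 1) * x * t))) with hG
  have hpos : ∀ n : ℕ, 0 < ((n : ℝ) + 1) * x := fun n => by positivity
  have hint : ∀ n, IntegrableOn (G n) (Ioi 0) := fun n =>
    (integrableOn_binetKernel_mul_exp (hpos n)).const_mul _
  have hnorm : ∀ n, ∫ t in Ioi 0, ‖G n t‖ ≤ 1 / x * (1 / ((n : ℝ) + 1) ^ 2) := by
    intro n
    have h1 : ∫ t in Ioi 0, ‖G n t‖ = 1 / ((n : ℝ) + 1) *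
        ∫ t in Ioi 0, binetKernel t * Real.exp (-(((n : ℝ) + 1) * x * t)) := by
      rw [← integral_const_mul]
      refine setIntegral_congr_fun measurableSet_Ioi fun t ht => ?_
      have hn : (0 : ℝ) < (n : ℝ) + 1 := by positivity
      simp only [hG]
      rw [Real.norm_eq_abs, abs_mul, abs_mul, Real.abs_exp, abs_of_nonneg (binetKernel_nonneg ht),
        abs_div, abs_neg, abs_one, abs_of_pos hn]
    rw [h1]
    refine (mul_le_mul_of_nonneg_left (integral_binetKernel_mul_exp_le (hpos n))
      (by positivity)).trans_eq ?_
    field_simp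
  have hsum : Summable fun n => ∫ t in Ioi 0, ‖G n t‖ := by
    refine Summable.of_nonneg_of_le (fun n => by positivity) hnorm (Summable.mul_left _ ?_)
    exact_mod_cast (summable_nat_add_iff 1).2 (Real.summable_one_div_nat_pow.2 one_lt_two)
  have hts : ∀ t ∈ Ioi (0 : ℝ),
      ∑' n, G n t = binetKernel t * Real.log (1 - Real.exp (-(x * t))) := by
    intro t ht
    have hlt : |Real.exp (-(x * t))| < 1 := by
      rw [Real.abs_exp]
      exact Real.exp_lt_one_iff.2 (neg_lt_zero.2 (mul_pos hx ht))
    have h := (Real.hasSum_pow_div_log_of_abs_lt_one hlt).mul_left (-binetKernel t)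
    rw [neg_mul_neg] at h
    rw [← h.tsum_eq]
    refine tsum_congr fun n => ?_
    simp only [hG]
    rw [← Real.exp_nat_mul]
    push_cast
    ring_nf
  have h := hasSum_integral_of_summable_integral_norm hint hsum
  rw [setIntegral_congr_fun measurableSet_Ioi hts] at h
  rw [← h.tsum_eq, herglotzF]
  refine tsum_congr fun n => ?_
  simp only [hG]
  rw [integral_const_mul, digamma_sub_log_eq_integral (hpos n)]
  ring

/-- The pairing `∫ t w(αt) h(βt) dt` of Binet's kernel with the Bose kernel. -/
noncomputable def binetBosePairing (α β : ℝ) : ℝ :=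
  ∫ t in Ioi 0, t * (binetKernel (α * t) * boseKernel (β * t))

theorem integrableOn_mul_boseKernel {β : ℝ} (hβ : 0 < β) :
    IntegrableOn (fun t => t * boseKernel (β * t)) (Ioi 0) := by
  refine integrableOn_of_abs_le (by fun_prop)
    ((integrableOn_exp_neg_mul (half_pos hβ)).const_mul (1 / β)) fun t ht => ?_
  rw [abs_of_pos (mul_pos ht (boseKernel_pos (mul_pos hβ ht)))]
  exact mul_boseKernel_le_exp hβ le_rfl ht

theorem integrableOn_binetBosePairing {α β : ℝ} (hα : 0 < α) (hβ : 0 < β) :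
    IntegrableOn (fun t => t * (binetKernel (α * t) * boseKernel (β * t))) (Ioi 0) := by
  refine integrableOn_of_abs_le (by fun_prop) (integrableOn_mul_boseKernel hβ) fun t ht => ?_
  have h1 := boseKernel_pos (mul_pos hβ ht)
  have h2 := mul_pos hα ht
  rw [abs_of_nonneg (mul_nonneg ht.le (mul_nonneg (binetKernel_nonneg h2) h1.le))]
  exact mul_le_mul_of_nonneg_left (mul_le_of_le_one_left h1.le (binetKernel_le_one h2)) ht.le

theorem binetBosePairing_mul_mul {c : ℝ} (hc : 0 < c) (α β : ℝ) :
    binetBosePairing (c * α) (c * β) = binetBosePairing α β / c ^ 2 := by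
  have h := integral_comp_mul_left_Ioi
    (fun t => t * (binetKernel (α * t) * boseKernel (β * t))) 0 hc
  rw [mul_zero, smul_eq_mul] at h
  have h2 : binetBosePairing (c * α) (c * β) = c⁻¹ *
      ∫ t in Ioi 0, c * t * (binetKernel (α * (c * t)) * boseKernel (β * (c * t))) := by
    rw [← integral_const_mul, binetBosePairing]
    congr 1
    ext t
    field_simp
  rw [h2, h, binetBosePairing]
  ring

theorem hasDerivAt_log_one_sub_exp_neg {u : ℝ} (hu : 0 < u) :
    HasDerivAt (fun u => Real.log (1 - Real.exp (-u))) (boseKernel u) u := by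
  have h0 : Real.exp (-u) < 1 := Real.exp_lt_one_iff.2 (neg_lt_zero.2 hu)
  have h := (((hasDerivAt_neg u).exp).const_sub 1).log (by linarith)
  convert! h using 1
  have := exp_sub_one_pos hu
  have h1 : 1 - Real.exp (-u) ≠ 0 := by linarith
  unfold boseKernel
  rw [Real.exp_neg] at h1 ⊢
  field_simp

theorem hasDerivAt_herglotzF {x : ℝ} (hx : 0 < x) :
    HasDerivAt herglotzF (binetBosePairing 1 x) x := by
  have hd := (hasDerivAt_integral_of_dominated_loc_of_deriv_le
    (μ := volume.restrict (Ioi (0 : ℝ)))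
    (F := fun y t => binetKernel t * Real.log (1 - Real.exp (-(y * t))))
    (F' := fun y t => t * (binetKernel (1 * t) * boseKernel (y * t)))
    (bound := fun t => 1 / (x / 2) * Real.exp (-(x / 2 / 2 * t))) (x₀ := x)
    (s := Ioi (x / 2)) (Ioi_mem_nhds (half_lt_self hx))
    (Eventually.of_forall fun y => (by fun_prop : Measurable _).aestronglyMeasurable)
    (integrableOn_binetKernel_mul_log hx)
    (integrableOn_binetBosePairing one_pos hx).aestronglyMeasurable
    ((ae_restrict_mem measurableSet_Ioi).mono fun t ht y hy => ?_)
    ((integrableOn_exp_neg_mul (by positivity)).const_mul _)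
    ((ae_restrict_mem measurableSet_Ioi).mono fun t ht y hy => ?_)).2
  · refine hd.congr_of_eventuallyEq ?_
    filter_upwards [lt_mem_nhds hx] with y hy
    exact herglotzF_eq_integral hy
  · have ht' : 0 < t := ht
    have hy' : x / 2 < y := hy
    have h1 := boseKernel_pos (mul_pos ((half_pos hx).trans hy') ht')
    rw [Real.norm_eq_abs, one_mul,
      abs_of_nonneg (mul_nonneg ht'.le (mul_nonneg (binetKernel_nonneg ht') h1.le))]
    exact (mul_le_mul_of_nonneg_left (mul_le_of_le_one_left h1.le (binetKernel_le_one ht'))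
      ht'.le).trans (mul_boseKernel_le_exp (half_pos hx) hy'.le ht')
  · have ht' : 0 < t := ht
    have hy' : x / 2 < y := hy
    have h1 := (hasDerivAt_log_one_sub_exp_neg (mul_pos ((half_pos hx).trans hy') ht')).comp y
      ((hasDerivAt_id y).mul_const t)
    convert! h1.const_mul (binetKernel t) using 1
    ring_nf

theorem tendsto_log_one_sub_exp_neg_mul_div {c : ℝ} (hc : 0 < c) :
    Tendsto (fun s => Real.log ((1 - Real.exp (-(c * s))) / s)) (𝓝[>] 0) (𝓝 (Real.log c)) := by
  have hd : HasDerivAt (fun s => 1 - Real.exp (-(c * s))) c 0 := by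
    have h := (((hasDerivAt_id (0 : ℝ)).const_mul c).neg.exp).const_sub 1
    convert! h using 1
    simp
  have h := (hasDerivAt_iff_tendsto_slope.1 hd).mono_left
    (nhdsWithin_mono 0 fun s (hs : 0 < s) => hs.ne')
  refine ((Real.continuousAt_log hc.ne').tendsto.comp h).congr fun s => ?_
  simp [slope_def_field]

theorem tendsto_log_one_sub_exp_neg_mul_atTop {c : ℝ} (hc : 0 < c) :
    Tendsto (fun s => Real.log (1 - Real.exp (-(c * s)))) atTop (𝓝 0) := by
  have h1 : Tendsto (fun s => 1 - Real.exp (-(c * s))) atTop (𝓝 (1 - 0)) :=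
    (Real.tendsto_exp_neg_atTop_nhds_zero.comp (tendsto_id.const_mul_atTop hc)).const_sub 1
  have h2 := (Real.continuousAt_log (by norm_num : (1 - 0 : ℝ) ≠ 0)).tendsto.comp h1
  simpa [Function.comp_def] using h2

/-- A convergent integral of a combination of dilated Bose kernels whose poles at `0` cancel. -/
theorem integral_boseKernel_combination {a b c p q r : ℝ} (hp : 0 < p) (hq : 0 < q) (hr : 0 < r)
    (h0 : a / p + b / q + c / r = 0)
    (hint : IntegrableOn (fun s => a * boseKernel (p * s) + b * boseKernel (q * s)
      + c * boseKernel (r * s)) (Ioi 0)) :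
    ∫ s in Ioi 0, (a * boseKernel (p * s) + b * boseKernel (q * s) + c * boseKernel (r * s)) =
      -(a / p * Real.log p + b / q * Real.log q + c / r * Real.log r) := by
  set ℓ : ℝ → ℝ → ℝ := fun k s => Real.log (1 - Real.exp (-(k * s))) with hℓ
  set f : ℝ → ℝ := fun s => a / p * ℓ p s + b / q * ℓ q s + c / r * ℓ r s with hf
  set m := a / p * Real.log p + b / q * Real.log q + c / r * Real.log r with hm
  have hderiv : ∀ k s, 0 < k → 0 < s → HasDerivAt (ℓ k) (k * boseKernel (k * s)) s := by
    intro k s hk hs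
    have h := (hasDerivAt_log_one_sub_exp_neg (mul_pos hk hs)).comp s
      ((hasDerivAt_id s).const_mul k)
    convert! h using 1
    simp [mul_comm]
  have hfd : ∀ s ∈ Ioi (0 : ℝ), HasDerivAt (Function.update f 0 m)
      (a * boseKernel (p * s) + b * boseKernel (q * s) + c * boseKernel (r * s)) s := by
    intro s hs
    have h := (((hderiv p s hp hs).const_mul (a / p)).add
      ((hderiv q s hq hs).const_mul (b / q))).add ((hderiv r s hr hs).const_mul (c / r))
    have h' : HasDerivAt f
        (a * boseKernel (p * s) + b * boseKernel (q * s) + c * boseKernel (r * s)) s := by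
      convert! h using 1
      field_simp
    refine h'.congr_of_eventuallyEq ?_
    filter_upwards [lt_mem_nhds (mem_Ioi.1 hs)] with u hu
    exact Function.update_of_ne hu.ne' _ _
  have hzero : Tendsto f (𝓝[>] 0) (𝓝 m) := by
    have h := (((tendsto_log_one_sub_exp_neg_mul_div hp).const_mul (a / p)).add
      ((tendsto_log_one_sub_exp_neg_mul_div hq).const_mul (b / q))).add
      ((tendsto_log_one_sub_exp_neg_mul_div hr).const_mul (c / r))
    refine h.congr' ?_
    filter_upwards [self_mem_nhdsWithin] with s hs
    have hs' : 0 < s := hs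
    have key : ∀ k, 0 < k → Real.log ((1 - Real.exp (-(k * s))) / s) = ℓ k s - Real.log s := by
      intro k hk
      have : Real.exp (-(k * s)) < 1 := Real.exp_lt_one_iff.2 (neg_lt_zero.2 (mul_pos hk hs'))
      rw [Real.log_div (by linarith) hs'.ne']
    rw [key p hp, key q hq, key r hr]
    simp only [hf]
    linear_combination (-Real.log s) * h0
  have htop : Tendsto (Function.update f 0 m) atTop (𝓝 0) := by
    have h := (((tendsto_log_one_sub_exp_neg_mul_atTop hp).const_mul (a / p)).add
      ((tendsto_log_one_sub_exp_neg_mul_atTop hq).const_mul (b / q))).add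
      ((tendsto_log_one_sub_exp_neg_mul_atTop hr).const_mul (c / r))
    simp only [mul_zero, add_zero] at h
    refine h.congr' ?_
    filter_upwards [eventually_gt_atTop 0] with s hs
    rw [Function.update_of_ne hs.ne']
  have hcont : ContinuousWithinAt (Function.update f 0 m) (Ici 0) 0 := by
    rw [continuousWithinAt_update_same, Ici_sdiff_left]
    exact hzero
  have h := integral_Ioi_of_hasDerivAt_of_tendsto hcont hfd hint htop
  rw [h, Function.update_self, zero_sub]

theorem mul_binetKernel_mul {α t : ℝ} (hα : 0 < α) (ht : 0 < t) :
    t * binetKernel (α * t) = t * (1 + boseKernel (α * t)) - 1 / α := by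
  unfold binetKernel
  field_simp

theorem boseKernel_two_mul {u : ℝ} : boseKernel (2 * u) = 1 / (Real.exp u ^ 2 - 1) := by
  rw [boseKernel, two_mul, Real.exp_add, pow_two]

/-- The identity between hyperbolic cotangents behind the second Hecke operator. -/
theorem boseKernel_hecke_two {u v : ℝ} (hu : 0 < u) (hv : 0 < v) :
    (1 + boseKernel u) * boseKernel (2 * v) + (1 + boseKernel (2 * u)) * boseKernel v
      + (1 + boseKernel (2 * u)) * boseKernel (u + v)
      + (1 + boseKernel (u + v)) * boseKernel (2 * v)
      - (1 + boseKernel u) * boseKernel v - 2 * ((1 + boseKernel (2 * u)) * boseKernel (2 * v))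
      = 0 := by
  have h1 := exp_sub_one_pos hu
  have h2 := exp_sub_one_pos hv
  have h3 := exp_sub_one_pos (add_pos hu hv)
  rw [boseKernel_two_mul, boseKernel_two_mul]
  unfold boseKernel
  rw [Real.exp_add] at h3 ⊢
  generalize Real.exp u = U at *
  generalize Real.exp v = V at *
  have h4 : U ^ 2 - 1 ≠ 0 := by nlinarith
  have h5 : V ^ 2 - 1 ≠ 0 := by nlinarith
  have h6 := h1.ne'
  have h7 := h2.ne'
  have h8 := h3.ne'
  have h9 : U + 1 ≠ 0 := by linarith
  have h10 : V + 1 ≠ 0 := by linarith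
  rw [show U ^ 2 - 1 = (U - 1) * (U + 1) by ring, show V ^ 2 - 1 = (V - 1) * (V + 1) by ring]
  field_simp
  ring

theorem binetBosePairing_hecke_two {x : ℝ} (hx : 0 < x) :
    2 * binetBosePairing 1 (2 * x) + 2 * binetBosePairing 2 x + 2 * binetBosePairing 2 (x + 1)
      + 2 * binetBosePairing (x + 1) (2 * x) - 2 * binetBosePairing 1 x
      - 4 * binetBosePairing 2 (2 * x) =
    -(1 / x * Real.log x - 1 / (x + 1) * Real.log (x + 1)
      - 1 / (x * (x + 1)) * Real.log (2 * x)) := by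
  have hx1 : 0 < x + 1 := by linarith
  have hx2 : 0 < 2 * x := by linarith
  have i1 := (integrableOn_binetBosePairing one_pos hx2).const_mul 2
  have i2 := (integrableOn_binetBosePairing two_pos hx).const_mul 2
  have i3 := (integrableOn_binetBosePairing two_pos hx1).const_mul 2
  have i4 := (integrableOn_binetBosePairing hx1 hx2).const_mul 2
  have i5 := (integrableOn_binetBosePairing one_pos hx).const_mul 2
  have i6 := (integrableOn_binetBosePairing two_pos hx2).const_mul 4
  have key : ∀ t ∈ Ioi (0 : ℝ),
      2 * (t * (binetKernel (1 * t) * boseKernel (2 * x * t)))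
        + 2 * (t * (binetKernel (2 * t) * boseKernel (x * t)))
        + 2 * (t * (binetKernel (2 * t) * boseKernel ((x + 1) * t)))
        + 2 * (t * (binetKernel ((x + 1) * t) * boseKernel (2 * x * t)))
        - 2 * (t * (binetKernel (1 * t) * boseKernel (x * t)))
        - 4 * (t * (binetKernel (2 * t) * boseKernel (2 * x * t)))
      = 1 * boseKernel (x * t) + (-1) * boseKernel ((x + 1) * t)
        + (-(2 / (x + 1))) * boseKernel (2 * x * t) := by
    intro t ht
    simp only [← mul_assoc]
    simp only [mul_assoc _ t (binetKernel _), mul_binetKernel_mul one_pos ht,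
      mul_binetKernel_mul two_pos ht, mul_binetKernel_mul hx1 ht]
    have h := boseKernel_hecke_two ht (mul_pos hx ht)
    rw [show t + x * t = (x + 1) * t by ring, show 2 * (x * t) = 2 * x * t by ring] at h
    rw [one_mul]
    linear_combination 2 * t * h
  have hI : IntegrableOn _ (Ioi (0 : ℝ)) := ((((i1.add i2).add i3).add i4).sub i5).sub i6
  have hE := integral_boseKernel_combination (a := 1) (b := -1) (c := -(2 / (x + 1)))
    hx hx1 hx2 (by field_simp; ring) (hI.congr_fun key measurableSet_Ioi)
  have e1 := integral_sub ((((i1.add i2).add i3).add i4).sub i5) i6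
  have e2 := integral_sub (((i1.add i2).add i3).add i4) i5
  have e3 := integral_add ((i1.add i2).add i3) i4
  have e4 := integral_add (i1.add i2) i3
  simp only [Pi.add_apply, Pi.sub_apply] at e1 e2 e3 e4
  rw [← setIntegral_congr_fun measurableSet_Ioi key, e1, e2, e3, e4, integral_add i1 i2] at hE
  simp only [integral_const_mul] at hE
  simp only [binetBosePairing]
  rw [hE]
  field_simp
  ring

theorem integral_mul_boseKernel : ∫ t in Ioi 0, t * boseKernel t = Real.pi ^ 2 / 6 := by
  set G : ℕ → ℝ → ℝ := fun n t => t * Real.exp (-(((n : ℝ) + 1) * t)) with hG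
  have hval : ∀ n : ℕ, ∫ t in Ioi 0, G n t = 1 / ((n : ℝ) + 1) ^ 2 := by
    intro n
    have h := Real.integral_rpow_mul_exp_neg_mul_Ioi two_pos (by positivity : (0 : ℝ) < n + 1)
    norm_num at h
    simpa [hG] using h
  have hint : ∀ n, IntegrableOn (G n) (Ioi 0) := fun n => by
    by_contra h
    have h' := hval n
    rw [integral_undef h] at h'
    have : (0 : ℝ) < 1 / ((n : ℝ) + 1) ^ 2 := by positivity
    linarith
  have hnorm : ∀ n, ∫ t in Ioi 0, ‖G n t‖ = 1 / ((n : ℝ) + 1) ^ 2 := fun n => by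
    rw [← hval n]
    exact setIntegral_congr_fun measurableSet_Ioi fun t ht =>
      Real.norm_of_nonneg (mul_nonneg (mem_Ioi.1 ht).le (Real.exp_pos _).le)
  have hz : HasSum (fun n : ℕ => 1 / ((n : ℝ) + 1) ^ 2) (Real.pi ^ 2 / 6) := by
    have := (hasSum_nat_add_iff' 1).2 hasSum_zeta_two
    simpa using this
  have h := hasSum_integral_of_summable_integral_norm hint (by simp_rw [hnorm]; exact hz.summable)
  simp_rw [hval] at h
  rw [hz.unique h]
  refine setIntegral_congr_fun measurableSet_Ioi fun t ht => ?_
  have hlt : Real.exp (-t) < 1 := Real.exp_lt_one_iff.2 (neg_lt_zero.2 ht)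
  have hg := ((hasSum_geometric_of_lt_one (Real.exp_pos (-t)).le hlt).mul_left
    (t * Real.exp (-t))).tsum_eq
  have hb : boseKernel t = Real.exp (-t) * (1 - Real.exp (-t))⁻¹ := by
    have := one_add_boseKernel (mem_Ioi.1 ht)
    have h1 : 1 - Real.exp (-t) ≠ 0 := by linarith
    field_simp at this ⊢
    linear_combination this
  rw [hb, ← mul_assoc, ← hg]
  refine tsum_congr fun n => ?_
  simp only [hG]
  rw [← Real.exp_nat_mul, mul_assoc, ← Real.exp_add]
  ring_nf

theorem integral_mul_boseKernel_mul {c : ℝ} (hc : 0 < c) :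
    ∫ t in Ioi 0, t * boseKernel (c * t) = Real.pi ^ 2 / 6 / c ^ 2 := by
  have h := integral_comp_mul_left_Ioi (fun t => t * boseKernel t) 0 hc
  rw [mul_zero, smul_eq_mul, integral_mul_boseKernel] at h
  simp only [mul_assoc] at h
  rw [integral_const_mul] at h
  field_simp at h ⊢
  linarith

theorem binetBosePairing_sub_swap {x : ℝ} (hx : 0 < x) :
    binetBosePairing 1 x - binetBosePairing x 1 =
      Real.pi ^ 2 / 6 * (1 / x ^ 2 - 1) + Real.log x / x := by
  have i1 := integrableOn_binetBosePairing one_pos hx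
  have i2 := integrableOn_binetBosePairing hx one_pos
  have i3 := integrableOn_mul_boseKernel hx
  have i4 := integrableOn_mul_boseKernel one_pos
  have key : ∀ t ∈ Ioi (0 : ℝ),
      t * (binetKernel (1 * t) * boseKernel (x * t))
        - t * (binetKernel (x * t) * boseKernel (1 * t))
        - t * boseKernel (x * t) + t * boseKernel (1 * t)
      = (-1) * boseKernel (x * t) + 1 / x * boseKernel (1 * t) + 0 * boseKernel (1 * t) := by
    intro t ht
    simp only [← mul_assoc, mul_binetKernel_mul one_pos ht, mul_binetKernel_mul hx ht]
    ring
  have hE := integral_boseKernel_combination hx one_pos one_pos (by ring)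
    ((((i1.sub i2).sub i3).add i4).congr_fun key measurableSet_Ioi)
  have e1 := integral_add ((i1.sub i2).sub i3) i4
  have e2 := integral_sub (i1.sub i2) i3
  simp only [Pi.sub_apply] at e1 e2
  rw [← setIntegral_congr_fun measurableSet_Ioi key, e1, e2, integral_sub i1 i2,
    integral_mul_boseKernel_mul hx,
    integral_mul_boseKernel_mul one_pos, Real.log_one] at hE
  simp only [binetBosePairing]
  linear_combination hE

theorem hasDerivAt_Li2 {z : ℝ} (h0 : 0 < z) (h1 : z < 1) :
    HasDerivAt Li2 (-Real.log (1 - z) / z) z := by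
  obtain ⟨r, hzr, hr1⟩ := exists_between h1
  have hr0 : 0 < r := h0.trans hzr
  have h := hasDerivAt_tsum_of_isPreconnected (t := Ioo (-r) r) (u := fun n => r ^ n)
    (g := fun (n : ℕ) (y : ℝ) => y ^ (n + 1) / ((n : ℝ) + 1) ^ 2)
    (g' := fun (n : ℕ) (y : ℝ) => y ^ n / ((n : ℝ) + 1)) (y₀ := 0) (y := z)
    (summable_geometric_of_lt_one hr0.le hr1) isOpen_Ioo isPreconnected_Ioo
    (fun n y _ => ?_) (fun n y hy => ?_) ⟨neg_lt_zero.2 hr0, hr0⟩ ?_ ⟨by linarith, hzr⟩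
  · have hs := (Real.hasSum_pow_div_log_of_abs_lt_one (abs_lt.2 ⟨by linarith, h1⟩)).div_const z
    rw [← hs.tsum_eq]
    refine h.congr_deriv (tsum_congr fun n => ?_)
    rw [pow_succ]
    field_simp
  · refine ((hasDerivAt_pow (n + 1) y).div_const (((n : ℝ) + 1) ^ 2)).congr_deriv ?_
    push_cast
    field_simp
  · rw [Real.norm_eq_abs, abs_div, abs_pow, abs_of_pos (by positivity : (0 : ℝ) < (n : ℝ) + 1)]
    refine (div_le_self (by positivity) (by linarith [(n.cast_nonneg : (0 : ℝ) ≤ n)])).trans ?_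
    exact pow_le_pow_left₀ (abs_nonneg y) (abs_lt.2 hy).le n
  · simp

theorem hasDerivAt_rogersL {z : ℝ} (h0 : 0 < z) (h1 : z < 1) :
    HasDerivAt rogersL (-(Real.log (1 - z) / z + Real.log z / (1 - z)) / 2) z := by
  have h1' : 1 - z ≠ 0 := by linarith
  have h := (hasDerivAt_Li2 h0 h1).add (((Real.hasDerivAt_log h0.ne').mul
    (((hasDerivAt_id z).const_sub 1).log h1')).div_const 2)
  refine (h.congr_of_eventuallyEq ?_).congr_deriv ?_
  · filter_upwards [Ioo_mem_nhds h0 h1] with y hy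
    simp [rogersL, not_lt.2 hy.1.le, hy.2.le]
  · simp only [id]
    field_simp
    ring

theorem hasDerivAt_mathcalF {x : ℝ} (hx : 0 < x) :
    HasDerivAt mathcalF (binetBosePairing 1 x + Real.pi ^ 2 / 12 * (1 - 1 / x ^ 2)
      - Real.log x / (2 * x)) x := by
  have h := (((hasDerivAt_herglotzF hx).sub_const (herglotzF 1)).add
    ((((hasDerivAt_id x).sub_const 2).add (hasDerivAt_inv hx.ne')).const_mul
      (Real.pi ^ 2 / 12))).sub (((Real.hasDerivAt_log hx.ne').pow 2).div_const 4)
  refine (h.congr_of_eventuallyEq (Eventually.of_forall fun y => ?_)).congr_deriv ?_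
  · simp [mathcalF]
  · push_cast
    field_simp
    ring

theorem eq_of_hasDerivAt_zero_of_pos {f : ℝ → ℝ} (hf : ∀ x, 0 < x → HasDerivAt f 0 x)
    {x y : ℝ} (hx : 0 < x) (hy : 0 < y) : f x = f y :=
  isOpen_Ioi.is_const_of_deriv_eq_zero isPreconnected_Ioi
    (fun z hz => (hf z hz).differentiableAt.differentiableWithinAt)
    (fun z hz => (hf z hz).deriv) hx hy

theorem mathcalF_one : mathcalF 1 = 0 := by
  norm_num [mathcalF]

/-- The two-term functional equation of the modified Herglotz function. -/
theorem mathcalF_add_mathcalF_inv {x : ℝ} (hx : 0 < x) : mathcalF x + mathcalF x⁻¹ = 0 := by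
  have hd : ∀ y, 0 < y → HasDerivAt (fun y => mathcalF y + mathcalF y⁻¹) 0 y := by
    intro y hy
    have h := (hasDerivAt_mathcalF hy).add
      ((hasDerivAt_mathcalF (inv_pos.2 hy)).comp y (hasDerivAt_inv hy.ne'))
    refine h.congr_deriv ?_
    have hs := binetBosePairing_sub_swap hy
    have hm := binetBosePairing_mul_mul hy 1 y⁻¹
    rw [mul_one, mul_inv_cancel₀ hy.ne'] at hm
    rw [hm] at hs
    rw [Real.log_inv]
    field_simp at hs ⊢
    linear_combination 4 * hs
  rw [eq_of_hasDerivAt_zero_of_pos hd hx one_pos]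
  simp [mathcalF_one]

theorem hasDerivAt_mathcalF_hecke_two {x : ℝ} (hx : 0 < x) :
    HasDerivAt (fun x => mathcalF (2 * x) + mathcalF (x / 2) + mathcalF ((x + 1) / 2)
        + mathcalF (2 * x / (x + 1)) - 3 * mathcalF x
        - (rogersL (x / (x + 1)) - rogersL (1 / 2) + Real.log 2 * Real.log x / 2)) 0 x := by
  have hx1 : 0 < x + 1 := by linarith
  have hx2 : 0 < 2 * x := by linarith
  have hz1 : x / (x + 1) < 1 := (div_lt_one hx1).2 (by linarith)
  have d1 := (hasDerivAt_mathcalF hx2).comp x ((hasDerivAt_id x).const_mul 2)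
  have d2 := (hasDerivAt_mathcalF (half_pos hx)).comp x ((hasDerivAt_id x).div_const 2)
  have d3 := (hasDerivAt_mathcalF (half_pos hx1)).comp x
    (((hasDerivAt_id x).add_const 1).div_const 2)
  have d4 := (hasDerivAt_mathcalF (div_pos hx2 hx1)).comp x
    (((hasDerivAt_id x).const_mul 2).div ((hasDerivAt_id x).add_const 1) hx1.ne')
  have d5 := (hasDerivAt_mathcalF hx).const_mul 3
  have d6 := (hasDerivAt_rogersL (div_pos hx hx1) hz1).comp x
    ((hasDerivAt_id x).div ((hasDerivAt_id x).add_const 1) hx1.ne')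
  have d7 := ((Real.hasDerivAt_log hx.ne').const_mul (Real.log 2)).div_const 2
  refine (((((d1.add d2).add d3).add d4).sub d5).sub
    ((d6.sub_const (rogersL (1 / 2))).add d7)).congr_deriv ?_
  have q2 := binetBosePairing_mul_mul two_pos 1 (x / 2)
  have q3 := binetBosePairing_mul_mul two_pos 1 ((x + 1) / 2)
  have q4 := binetBosePairing_mul_mul hx1 1 (2 * x / (x + 1))
  have q6 := binetBosePairing_mul_mul two_pos 1 x
  rw [mul_one, mul_div_cancel₀ _ two_ne_zero] at q2 q3
  rw [mul_one, mul_div_cancel₀ _ hx1.ne'] at q4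
  rw [mul_one] at q6
  have hq := binetBosePairing_hecke_two hx
  rw [q2, q3, q4, q6, Real.log_mul two_ne_zero hx.ne'] at hq
  have hz : 1 - x / (x + 1) = (x + 1)⁻¹ := by field_simp; ring
  rw [hz, Real.log_inv, Real.log_div hx2.ne' hx1.ne', Real.log_mul two_ne_zero hx.ne',
    Real.log_div hx.ne' two_ne_zero, Real.log_div hx1.ne' two_ne_zero,
    Real.log_div hx.ne' hx1.ne']
  simp only [id]
  have hQ : binetBosePairing 1 (2 * x / (x + 1)) = (x + 1) ^ 2 / 2 * (
      -(1 / x * Real.log x - 1 / (x + 1) * Real.log (x + 1)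
      - 1 / (x * (x + 1)) * (Real.log 2 + Real.log x)) - (2 * binetBosePairing 1 (2 * x)
      + binetBosePairing 1 (x / 2) / 2 + binetBosePairing 1 ((x + 1) / 2) / 2
      - 3 * binetBosePairing 1 x)) := by
    rw [← hq]
    field_simp
    ring
  rw [hQ]
  field_simp
  ring

end

/-- The functional equation for 𝓕 coming from the second Hecke operator. -/
theorem mathcalF_Hecke_two (x : ℝ) (hx : 0 < x) :
    mathcalF (2 * x) + mathcalF (x / 2) + mathcalF ((x + 1) / 2)
        + mathcalF (2 * x / (x + 1)) - 3 * mathcalF x =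
      rogersL (x / (x + 1)) - rogersL (1 / 2) + Real.log 2 * Real.log x / 2 := by
  have h := eq_of_hasDerivAt_zero_of_pos (fun y hy => hasDerivAt_mathcalF_hecke_two hy) hx one_pos
  have h2 := mathcalF_add_mathcalF_inv two_pos
  norm_num [mathcalF_one] at h h2
  linarith
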